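/- Let d ≥ 2, let μ, x⋆ ∈ ℝ^d, let Σ be a d×d positive definite covariance matrix, and let X be a random vector with the Gaussian distribution N(μ, Σ) on ℝ^d. Then the matrix E[(I_d − (X−x⋆)(X−x⋆)ᵀ/‖X−x⋆‖₂²)/‖X−x⋆‖₂] (the expected Hessian of x ↦ ‖x − x⋆‖₂ at X; this expectation exists entrywise since d ≥ 2) satisfies, in the positive semidefinite order, E[(I_d − (X−x⋆)(X−x⋆)ᵀ/‖X−x⋆‖₂²)/‖X−x⋆‖₂] ⪰ (1/2)·6^{−d/2}·exp(−(μ−x⋆)ᵀΣ⁻¹(μ−x⋆))·‖Σ‖^{−1/2}·I_d, where ‖Σ‖ is the operator norm of Σ. -/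

import Mathlib

open MeasureTheory Matrix

/-- The density of the Gaussian distribution `N(μ, Σ)` on `ℝ^d` (for `Σ` positive
definite) with respect to Lebesgue measure. -/
noncomputable def gaussPdf (d : ℕ) (μ : Fin d → ℝ) (S : Matrix (Fin d) (Fin d) ℝ)
    (x : Fin d → ℝ) : ℝ :=
  (2 * Real.pi) ^ (-(d : ℝ) / 2) * Real.sqrt S.det⁻¹ *
    Real.exp (-(1 / 2) * ((x - μ) ⬝ᵥ S⁻¹.mulVec (x - μ)))


noncomputable def nsq {d : ℕ} (z : Fin d → ℝ) : ℝ := ∑ k, z k ^ 2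

noncomputable def qf {d : ℕ} (s z : Fin d → ℝ) : ℝ := ∑ k, s k ^ 2 * z k ^ 2

lemma nsq_nonneg {d : ℕ} (z : Fin d → ℝ) : 0 ≤ nsq z := by unfold nsq; positivity

lemma qf_nonneg {d : ℕ} (s z : Fin d → ℝ) : 0 ≤ qf s z := by unfold qf; positivity

lemma sq_le_nsq {d : ℕ} (z : Fin d → ℝ) (k : Fin d) : z k ^ 2 ≤ nsq z :=
  Finset.single_le_sum (f := fun k => z k ^ 2) (fun _ _ => sq_nonneg _) (Finset.mem_univ k)

lemma sq_le_qf {d : ℕ} (s z : Fin d → ℝ) (k : Fin d) : s k ^ 2 * z k ^ 2 ≤ qf s z :=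
  Finset.single_le_sum (f := fun k => s k ^ 2 * z k ^ 2) (fun _ _ => by positivity)
    (Finset.mem_univ k)

lemma continuous_nsq {d : ℕ} : Continuous (nsq (d := d)) := by unfold nsq; fun_prop

lemma continuous_qf {d : ℕ} (s : Fin d → ℝ) : Continuous (qf s) := by unfold qf; fun_prop

lemma norm_sq_le_nsq {d : ℕ} (z : Fin d → ℝ) : ‖z‖ ^ 2 ≤ nsq z := by
  have h : ‖z‖ ≤ Real.sqrt (nsq z) := by
    rw [pi_norm_le_iff_of_nonneg (Real.sqrt_nonneg _)]
    intro i
    rw [Real.norm_eq_abs]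
    exact Real.abs_le_sqrt (sq_le_nsq z i)
  calc ‖z‖ ^ 2 ≤ Real.sqrt (nsq z) ^ 2 := by gcongr
    _ = nsq z := Real.sq_sqrt (nsq_nonneg z)

lemma nsq_pos {d : ℕ} {z : Fin d → ℝ} (hz : z ≠ 0) : 0 < nsq z :=
  lt_of_lt_of_le (by have := norm_pos_iff.2 hz; positivity) (norm_sq_le_nsq z)

lemma exp_nsq_eq {d : ℕ} (c : ℝ) (z : Fin d → ℝ) :
    Real.exp (-c * nsq z) = ∏ k, Real.exp (-c * z k ^ 2) := by
  rw [← Real.exp_sum, nsq, Finset.mul_sum]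

lemma integrable_gauss {d : ℕ} {c : ℝ} (hc : 0 < c) :
    Integrable (fun z : Fin d → ℝ => Real.exp (-c * nsq z)) := by
  simp_rw [exp_nsq_eq]
  exact Integrable.fintype_prod (f := fun _ x => Real.exp (-c * x ^ 2))
    (fun _ => integrable_exp_neg_mul_sq hc)

lemma integral_gauss {d : ℕ} (c : ℝ) :
    ∫ z : Fin d → ℝ, Real.exp (-c * nsq z) = Real.sqrt (Real.pi / c) ^ d := by
  simp_rw [exp_nsq_eq]
  rw [integral_fintype_prod_volume_eq_pow (fun x : ℝ => Real.exp (-c * x ^ 2)), integral_gaussian]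
  simp

lemma integrable_inv_gauss {d : ℕ} (hd : 2 ≤ d) {c : ℝ} (hc : 0 < c) :
    Integrable (fun z : Fin d → ℝ => (Real.sqrt (nsq z))⁻¹ * Real.exp (-c * nsq z)) := by
  have h1 : Integrable (fun z : Fin d → ℝ => ‖z‖⁻¹ * Real.exp (-c * ‖z‖ ^ 2)) := by
    have : Nonempty (Fin d) := ⟨⟨0, by omega⟩⟩
    rw [MeasureTheory.integrable_fun_norm_addHaar (E := Fin d → ℝ) volume
      (f := fun r => r⁻¹ * Real.exp (-c * r ^ 2))]
    refine (integrableOn_rpow_mul_exp_neg_mul_sq hc (s := ((d - 2 : ℕ) : ℝ))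
      (by have : (0:ℝ) ≤ ((d - 2 : ℕ) : ℝ) := by positivity
          linarith)).congr_fun ?_ measurableSet_Ioi
    intro y hy
    have hy' : (0:ℝ) < y := hy
    simp only [Module.finrank_fintype_fun_eq_card, Fintype.card_fin, smul_eq_mul,
      Real.rpow_natCast]
    obtain ⟨e, rfl⟩ : ∃ e, d = e + 2 := ⟨d - 2, by omega⟩
    simp only [Nat.add_sub_cancel, show e + 2 - 1 = e + 1 by omega, pow_succ]
    field_simp
  refine h1.mono' ?_ ?_
  · have := continuous_nsq (d := d)
    exact Measurable.aestronglyMeasurable (by fun_prop)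
  · refine Filter.Eventually.of_forall fun z => ?_
    rw [Real.norm_of_nonneg (by positivity)]
    have hz := norm_sq_le_nsq z
    by_cases h0 : z = 0
    · subst h0
      simp [nsq]
    have hp := norm_pos_iff.2 h0
    have : ‖z‖ ≤ Real.sqrt (nsq z) := Real.le_sqrt_of_sq_le hz
    have h3 : -c * nsq z ≤ -c * ‖z‖ ^ 2 := by nlinarith
    gcongr

lemma line_deriv_qf {d : ℕ} (s : Fin d → ℝ) (k : Fin d) (x : Fin d → ℝ) :
    HasLineDerivAt ℝ (qf s) (2 * s k ^ 2 * x k) x (Pi.single k 1) := by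
  unfold HasLineDerivAt qf
  have h : ∀ i ∈ (Finset.univ : Finset (Fin d)),
      HasDerivAt (fun t : ℝ => s i ^ 2 * (x + t • (Pi.single k 1 : Fin d → ℝ)) i ^ 2)
      (s i ^ 2 * (2 * x i * (Pi.single k 1 : Fin d → ℝ) i)) 0 := by
    intro i _
    have h0 : HasDerivAt (fun t : ℝ => (x + t • (Pi.single k 1 : Fin d → ℝ)) i)
        ((Pi.single k 1 : Fin d → ℝ) i) 0 := by
      simp only [Pi.add_apply, Pi.smul_apply, smul_eq_mul]
      simpa using ((hasDerivAt_id (0:ℝ)).mul_const ((Pi.single k 1 : Fin d → ℝ) i)).const_add (x i)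
    have := (h0.pow 2).const_mul (s i ^ 2)
    simpa using this
  have := HasDerivAt.fun_sum h
  convert this using 1
  simp [Pi.single_apply]
  ring

lemma nsq_eq_qf {d : ℕ} (z : Fin d → ℝ) : nsq z = qf (fun _ => 1) z := by simp [nsq, qf]

lemma line_deriv_coord {d : ℕ} (k : Fin d) (x : Fin d → ℝ) :
    HasLineDerivAt ℝ (fun z : Fin d → ℝ => z k) 1 x (Pi.single k 1) := by
  unfold HasLineDerivAt
  simp only [Pi.add_apply, Pi.smul_apply, smul_eq_mul, Pi.single_eq_same, mul_one]
  exact (hasDerivAt_id (0:ℝ)).const_add (x k)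

lemma line_deriv_gauss {d : ℕ} (c : ℝ) (k : Fin d) (x : Fin d → ℝ) :
    HasLineDerivAt ℝ (fun z => Real.exp (-c * nsq z)) (-(2 * c * x k * Real.exp (-c * nsq x))) x
      (Pi.single k 1) := by
  have h := line_deriv_qf (fun _ => (1:ℝ)) k x
  have e : nsq (d := d) = qf (fun _ => (1:ℝ)) := funext nsq_eq_qf
  rw [e]
  unfold HasLineDerivAt at *
  have := (h.const_mul (-c)).exp
  refine HasDerivAt.congr_deriv this ?_
  simp
  ring

lemma ibp {d : ℕ} (c : ℝ) (k : Fin d) (f f' : (Fin d → ℝ) → ℝ)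
    (hf : ∀ x, HasLineDerivAt ℝ f (f' x) x (Pi.single k 1))
    (h1 : Integrable (fun x => f' x * Real.exp (-c * nsq x)))
    (h2 : Integrable (fun x => f x * (2 * c * x k * Real.exp (-c * nsq x))))
    (h3 : Integrable (fun x => f x * Real.exp (-c * nsq x))) :
    ∫ x, f' x * Real.exp (-c * nsq x) = ∫ x, f x * (2 * c * x k * Real.exp (-c * nsq x)) := by
  have := integral_bilinear_hasLineDerivAt_right_eq_neg_left_of_integrable
    (μ := (volume : Measure (Fin d → ℝ))) (f := f) (f' := f')
    (g := fun z => Real.exp (-c * nsq z)) (g' := fun x => -(2 * c * x k * Real.exp (-c * nsq x)))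
    (v := Pi.single k 1) (B := ContinuousLinearMap.mul ℝ ℝ)
    (by simpa using h1) (by simpa using h2.neg) (by simpa using h3) (fun x _ => hf x)
    (fun x _ => line_deriv_gauss c k x)
  simp only [ContinuousLinearMap.mul_apply', mul_neg, integral_neg] at this
  linarith

lemma abs_le_exp_half (t : ℝ) : |t| ≤ Real.exp (t ^ 2 / 2) := by
  have := Real.add_one_le_exp (t ^ 2 / 2)
  nlinarith [sq_abs t, sq_nonneg (|t| - 1)]

lemma integrable_coord_gauss {d : ℕ} {c : ℝ} (hc : 1 ≤ c) (k : Fin d) :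
    Integrable (fun z : Fin d → ℝ => |z k| * Real.exp (-c * nsq z)) := by
  refine (integrable_gauss (d := d) (c := 1/2) (by norm_num)).mono' ?_ ?_
  · have := continuous_nsq (d := d)
    exact Measurable.aestronglyMeasurable (by fun_prop)
  · refine Filter.Eventually.of_forall fun z => ?_
    rw [Real.norm_of_nonneg (by positivity)]
    calc _ ≤ Real.exp (z k ^ 2 / 2) * Real.exp (-c * nsq z) := by
          gcongr; exact abs_le_exp_half _
      _ = Real.exp (z k ^ 2 / 2 + -c * nsq z) := (Real.exp_add _ _).symm
      _ ≤ _ := by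
          apply Real.exp_le_exp.2
          have := sq_le_nsq z k
          nlinarith [nsq_nonneg z]

lemma integrable_sq_gauss {d : ℕ} {c : ℝ} (hc : 2 ≤ c) (k : Fin d) :
    Integrable (fun z : Fin d → ℝ => z k ^ 2 * Real.exp (-c * nsq z)) := by
  refine (integrable_gauss (d := d) (c := 1) (by norm_num)).mono' ?_ ?_
  · have := continuous_nsq (d := d)
    exact Measurable.aestronglyMeasurable (by fun_prop)
  · refine Filter.Eventually.of_forall fun z => ?_
    rw [Real.norm_of_nonneg (by positivity)]
    calc _ ≤ Real.exp (z k ^ 2) * Real.exp (-c * nsq z) := by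
          gcongr; linarith [Real.add_one_le_exp (z k ^ 2)]
      _ = Real.exp (z k ^ 2 + -c * nsq z) := (Real.exp_add _ _).symm
      _ ≤ _ := by
          apply Real.exp_le_exp.2
          have := sq_le_nsq z k
          nlinarith [nsq_nonneg z]

lemma integral_sq_gauss {d : ℕ} (k : Fin d) :
    ∫ z : Fin d → ℝ, z k ^ 2 * Real.exp (-3 * nsq z) = Real.sqrt (Real.pi / 3) ^ d / 6 := by
  have h := ibp (d := d) 3 k (fun z => z k) (fun _ => 1) (fun x => line_deriv_coord k x)
    (by simpa using integrable_gauss (d := d) (c := 3) (by norm_num))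
    (by
      convert (integrable_sq_gauss (d := d) (c := 3) (by norm_num) k).const_mul 6 using 2
      ring)
    (by
      refine (integrable_coord_gauss (c := 3) (by norm_num) k).mono ?_ ?_
      · have := continuous_nsq (d := d)
        exact Measurable.aestronglyMeasurable (by fun_prop)
      · refine Filter.Eventually.of_forall fun z => ?_
        simp)
  simp only [one_mul] at h
  rw [integral_gauss] at h
  rw [h, ← integral_div]
  congr 1
  ext z
  ring

lemma qf_lower {d : ℕ} (s : Fin d → ℝ) (hs : ∀ k, 0 < s k) :
    ∃ m : ℝ, 0 < m ∧ ∀ z, m * Real.sqrt (nsq z) ≤ Real.sqrt (qf s z) := by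
  have hm : ∃ m : ℝ, 0 < m ∧ ∀ k, m ≤ s k := by
    rcases isEmpty_or_nonempty (Fin d) with h | h
    · exact ⟨1, one_pos, fun k => h.elim k⟩
    · obtain ⟨k, hk⟩ := Finite.exists_min s
      exact ⟨s k, hs k, hk⟩
  obtain ⟨m, hm, hk⟩ := hm
  refine ⟨m, hm, fun z => ?_⟩
  apply Real.le_sqrt_of_sq_le
  rw [mul_pow, Real.sq_sqrt (nsq_nonneg z), nsq, qf, Finset.mul_sum]
  gcongr with k _
  exact hk k

lemma qf_pos {d : ℕ} {s : Fin d → ℝ} (hs : ∀ k, 0 < s k) {z : Fin d → ℝ} (hz : z ≠ 0) :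
    0 < qf s z := by
  obtain ⟨m, hm, h⟩ := qf_lower s hs
  have h1 := Real.sqrt_pos.2 (nsq_pos hz)
  exact Real.sqrt_pos.1 (lt_of_lt_of_le (by positivity) (h z))

lemma prod_le_qf {d : ℕ} (s z : Fin d → ℝ) (i j : Fin d) :
    |s i * z i * (s j * z j)| ≤ qf s z := by
  have h1 := sq_le_qf s z i
  have h2 := sq_le_qf s z j
  rw [abs_le]
  constructor <;> nlinarith [sq_nonneg (s i * z i - s j * z j), sq_nonneg (s i * z i + s j * z j)]

noncomputable def hz {d : ℕ} (s : Fin d → ℝ) (i j : Fin d) (ε : ℝ) (z : Fin d → ℝ) : ℝ :=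
  ((if i = j then (1:ℝ) else 0) - s i * z i * (s j * z j) / (qf s z + ε)) / Real.sqrt (qf s z + ε)

lemma hz_bound {d : ℕ} (s : Fin d → ℝ) (i j : Fin d) {ε : ℝ} (hε : 0 ≤ ε) (z : Fin d → ℝ) :
    |hz s i j ε z| ≤ 2 * (Real.sqrt (qf s z + ε))⁻¹ := by
  unfold hz
  rw [abs_div, abs_of_nonneg (Real.sqrt_nonneg _), div_eq_mul_inv]
  gcongr
  have h0 := qf_nonneg s z
  have h1 : |s i * z i * (s j * z j) / (qf s z + ε)| ≤ 1 := by
    rw [abs_div, abs_of_nonneg (a := qf s z + ε) (by positivity)]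
    apply div_le_one_of_le₀ _ (by positivity)
    linarith [prod_le_qf s z i j]
  have h2 : |(if i = j then (1:ℝ) else 0)| ≤ 1 := by split_ifs <;> simp
  linarith [abs_sub (if i = j then (1:ℝ) else 0) (s i * z i * (s j * z j) / (qf s z + ε))]

lemma hz_bound' {d : ℕ} (s : Fin d → ℝ) (hs : ∀ k, 0 < s k) (i j : Fin d) {ε : ℝ} (hε : 0 ≤ ε)
    {z : Fin d → ℝ} (h0 : z ≠ 0) :
    |hz s i j ε z| ≤ 2 * (Real.sqrt (qf s z))⁻¹ := by
  refine (hz_bound s i j hε z).trans ?_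
  have := Real.sqrt_pos.2 (qf_pos hs h0)
  have h2 : Real.sqrt (qf s z) ≤ Real.sqrt (qf s z + ε) := Real.sqrt_le_sqrt (by linarith)
  gcongr

lemma measurable_hz {d : ℕ} (s : Fin d → ℝ) (i j : Fin d) (ε : ℝ) : Measurable (hz s i j ε) := by
  unfold hz
  have := (continuous_qf s).measurable
  fun_prop

lemma ae_ne_zero {d : ℕ} (hd : 2 ≤ d) : ∀ᵐ z : Fin d → ℝ, z ≠ 0 := by
  have : Nonempty (Fin d) := ⟨⟨0, by omega⟩⟩
  exact MeasureTheory.Measure.ae_ne volume 0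

lemma integrable_hz_bd {d : ℕ} (hd : 2 ≤ d) (s : Fin d → ℝ) (hs : ∀ k, 0 < s k)
    {c : ℝ} (hc : 0 < c) :
    Integrable (fun z => 2 * (Real.sqrt (qf s z))⁻¹ * Real.exp (-c * nsq z)) := by
  obtain ⟨m, hm, h⟩ := qf_lower s hs
  refine ((integrable_inv_gauss hd hc).const_mul (2 * m⁻¹)).mono' ?_ ?_
  · have := (continuous_qf s).measurable
    have := (continuous_nsq (d := d)).measurable
    exact Measurable.aestronglyMeasurable (by fun_prop)
  · filter_upwards [ae_ne_zero hd] with z h0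
    rw [Real.norm_of_nonneg (by positivity)]
    have h1 := Real.sqrt_pos.2 (nsq_pos h0)
    calc _ ≤ 2 * (m * Real.sqrt (nsq z))⁻¹ * Real.exp (-c * nsq z) := by
          gcongr
          exact h z
      _ = _ := by rw [mul_inv]; ring

lemma integrable_hz {d : ℕ} (hd : 2 ≤ d) (s : Fin d → ℝ) (hs : ∀ k, 0 < s k) (i j : Fin d)
    {ε : ℝ} (hε : 0 ≤ ε) {c C : ℝ} (hc : 0 < c) (w : (Fin d → ℝ) → ℝ) (hw : Measurable w)
    (hwb : ∀ z, |w z| ≤ C * Real.exp (-c * nsq z)) :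
    Integrable (fun z => hz s i j ε z * w z) := by
  refine ((integrable_hz_bd hd s hs hc).const_mul C).mono' ?_ ?_
  · exact ((measurable_hz s i j ε).mul hw).aestronglyMeasurable
  · filter_upwards [ae_ne_zero hd] with z h0
    rw [norm_mul, Real.norm_eq_abs, Real.norm_eq_abs]
    calc _ ≤ (2 * (Real.sqrt (qf s z))⁻¹) * (C * Real.exp (-c * nsq z)) :=
          mul_le_mul (hz_bound' s hs i j hε h0) (hwb z) (abs_nonneg _) (by positivity)
      _ = _ := by ring

lemma integrable_hz1 {d : ℕ} (hd : 2 ≤ d) (s : Fin d → ℝ) (hs : ∀ k, 0 < s k) (i j : Fin d)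
    {ε : ℝ} (hε : 0 ≤ ε) : Integrable (fun z => hz s i j ε z * Real.exp (-1 * nsq z)) := by
  refine integrable_hz hd s hs i j hε one_pos (C := 1) _ ?_ ?_
  · have := (continuous_nsq (d := d)).measurable
    fun_prop
  · intro z
    rw [abs_of_pos (Real.exp_pos _), one_mul]

lemma hz_line {d : ℕ} (s : Fin d → ℝ) (k : Fin d) {ε : ℝ} (hε : 0 < ε) (x : Fin d → ℝ) :
    HasLineDerivAt ℝ (fun z => z k / Real.sqrt (qf s z + ε)) (hz s k k ε x) x (Pi.single k 1) := by
  have h1 := line_deriv_qf s k x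
  have h2 := line_deriv_coord k x
  unfold HasLineDerivAt at *
  have hq : 0 < qf s x + ε := by linarith [qf_nonneg s x]
  have h3 := h2.div ((h1.add_const ε).sqrt (by simpa using hq.ne'))
    (by simpa using (Real.sqrt_pos.2 hq).ne')
  refine HasDerivAt.congr_deriv h3 ?_
  have h4 := Real.sqrt_pos.2 hq
  have h5 := Real.sq_sqrt hq.le
  simp only [zero_smul, add_zero, hz, if_true]
  set r := Real.sqrt (qf s x + ε)
  rw [← h5]
  field_simp

lemma f_bound {d : ℕ} (s : Fin d → ℝ) (hs : ∀ k, 0 < s k) (k : Fin d) {ε : ℝ} (hε : 0 < ε)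
    (z : Fin d → ℝ) : |z k / Real.sqrt (qf s z + ε)| ≤ (s k)⁻¹ := by
  have hq : 0 < qf s z + ε := by linarith [qf_nonneg s z]
  have h4 := Real.sqrt_pos.2 hq
  have hk := hs k
  rw [abs_div, abs_of_pos h4, div_le_iff₀ h4, inv_mul_eq_div, le_div_iff₀ hk]
  apply Real.le_sqrt_of_sq_le
  rw [mul_pow, sq_abs]
  linarith [sq_le_qf s z k]

lemma Jeps {d : ℕ} (hd : 2 ≤ d) (s : Fin d → ℝ) (hs : ∀ k, 0 < s k) (k : Fin d) {Λ : ℝ}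
    (hΛ : 0 < Λ) (hsΛ : ∀ k, s k ^ 2 ≤ Λ) {e : ℝ} (he : 0 < e) (he' : e ≤ 1 / 3) :
    (1 / 2) * Real.sqrt (Real.pi / 3) ^ d / Real.sqrt Λ
      ≤ ∫ z, hz s k k (Λ * e) z * Real.exp (-1 * nsq z) := by
  have hε : 0 < Λ * e := by positivity
  have mq := (continuous_qf s).measurable
  have mn := (continuous_nsq (d := d)).measurable
  have i2 : Integrable (fun z : Fin d → ℝ =>
      z k / Real.sqrt (qf s z + Λ * e) * (2 * 1 * z k * Real.exp (-1 * nsq z))) := by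
    refine ((integrable_coord_gauss (le_refl 1) k).const_mul ((s k)⁻¹ * 2)).mono' ?_ ?_
    · exact Measurable.aestronglyMeasurable (by fun_prop)
    · refine Filter.Eventually.of_forall fun z => ?_
      rw [norm_mul, Real.norm_eq_abs, Real.norm_eq_abs]
      calc _ ≤ (s k)⁻¹ * |2 * 1 * z k * Real.exp (-1 * nsq z)| := by
            gcongr; exact f_bound s hs k hε z
        _ = _ := by rw [abs_mul, abs_mul, abs_of_pos (Real.exp_pos _)]; norm_num; ring
  rw [ibp 1 k (fun z => z k / Real.sqrt (qf s z + Λ * e)) (hz s k k (Λ * e))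
    (hz_line s k hε) (integrable_hz1 hd s hs k k hε.le) i2 ?_]
  · have : (1 / 2) * Real.sqrt (Real.pi / 3) ^ d / Real.sqrt Λ =
        ∫ z : Fin d → ℝ, 3 / Real.sqrt Λ * (z k ^ 2 * Real.exp (-3 * nsq z)) := by
      rw [integral_const_mul, integral_sq_gauss]; ring
    rw [this]
    refine integral_mono ((integrable_sq_gauss (by norm_num) k).const_mul _) i2 fun z => ?_
    have hn := nsq_nonneg z
    have hq : qf s z ≤ Λ * nsq z := by
      rw [qf, nsq, Finset.mul_sum]
      gcongr with k _
      exact hsΛ k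
    have h1 : Real.sqrt (qf s z + Λ * e) ≤ Real.sqrt Λ * Real.sqrt (nsq z + e) := by
      rw [← Real.sqrt_mul hΛ.le]
      apply Real.sqrt_le_sqrt
      linarith
    have h2 : Real.sqrt (nsq z + e) ≤ 2 / 3 * Real.exp (2 * nsq z) := by
      have a := Real.sq_sqrt (show 0 ≤ nsq z + e by positivity)
      have b := Real.add_one_le_exp (2 * nsq z)
      nlinarith [sq_nonneg (Real.sqrt (nsq z + e) - 1)]
    have h3 : 0 < Real.sqrt (qf s z + Λ * e) := Real.sqrt_pos.2 (by linarith [qf_nonneg s z])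
    have h4 := Real.sqrt_pos.2 hΛ
    have h5 : Real.sqrt (qf s z + Λ * e) ≤ Real.sqrt Λ * (2 / 3 * Real.exp (2 * nsq z)) :=
      h1.trans (by gcongr)
    have h6 : Real.exp (-1 * nsq z) = Real.exp (2 * nsq z) * Real.exp (-3 * nsq z) := by
      rw [← Real.exp_add]; congr 1; ring
    show 3 / Real.sqrt Λ * (z k ^ 2 * Real.exp (-3 * nsq z)) ≤
      z k / Real.sqrt (qf s z + Λ * e) * (2 * 1 * z k * Real.exp (-1 * nsq z))
    rw [h6]
    have e1 : 3 / Real.sqrt Λ * (z k ^ 2 * Real.exp (-3 * nsq z)) =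
      (z k ^ 2 * Real.exp (-3 * nsq z)) * (3 / Real.sqrt Λ) := by ring
    have e2 : z k / Real.sqrt (qf s z + Λ * e) *
        (2 * 1 * z k * (Real.exp (2 * nsq z) * Real.exp (-3 * nsq z))) =
      (z k ^ 2 * Real.exp (-3 * nsq z)) *
        (2 * Real.exp (2 * nsq z) / Real.sqrt (qf s z + Λ * e)) := by ring
    rw [e1, e2]
    gcongr ?_ * ?_
    rw [div_le_div_iff₀ h4 h3]
    linarith
  · refine ((integrable_gauss (d := d) (c := 1) one_pos).const_mul ((s k)⁻¹)).mono' ?_ ?_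
    · exact Measurable.aestronglyMeasurable (by fun_prop)
    · refine Filter.Eventually.of_forall fun z => ?_
      rw [norm_mul, Real.norm_eq_abs, Real.norm_eq_abs, abs_of_pos (Real.exp_pos _)]
      gcongr
      exact f_bound s hs k hε z

lemma Jdiag {d : ℕ} (hd : 2 ≤ d) (s : Fin d → ℝ) (hs : ∀ k, 0 < s k) (k : Fin d) {Λ : ℝ}
    (hΛ : 0 < Λ) (hsΛ : ∀ k, s k ^ 2 ≤ Λ) :
    (1 / 2) * Real.sqrt (Real.pi / 3) ^ d / Real.sqrt Λ
      ≤ ∫ z, hz s k k 0 z * Real.exp (-1 * nsq z) := by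
  have mn := (continuous_nsq (d := d)).measurable
  have ht : Filter.Tendsto (fun n : ℕ => Λ * (1 / ((n:ℝ) + 1) / 3)) Filter.atTop (nhds 0) := by
    have := ((tendsto_one_div_add_atTop_nhds_zero_nat (𝕜 := ℝ)).div_const 3).const_mul Λ
    simpa using this
  have hlim := tendsto_integral_of_dominated_convergence (μ := (volume : Measure (Fin d → ℝ)))
    (F := fun (n : ℕ) z => hz s k k (Λ * (1 / ((n:ℝ) + 1) / 3)) z * Real.exp (-1 * nsq z))
    (f := fun z => hz s k k 0 z * Real.exp (-1 * nsq z))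
    (fun z => 2 * (Real.sqrt (qf s z))⁻¹ * Real.exp (-1 * nsq z))
    (fun n => ((measurable_hz s k k _).mul (by fun_prop)).aestronglyMeasurable)
    (integrable_hz_bd hd s hs one_pos)
    (fun n => by
      filter_upwards [ae_ne_zero hd] with z h0
      rw [norm_mul, Real.norm_eq_abs, Real.norm_eq_abs, abs_of_pos (Real.exp_pos _)]
      gcongr
      exact hz_bound' s hs k k (by positivity) h0)
    (by
      filter_upwards [ae_ne_zero hd] with z h0
      apply Filter.Tendsto.mul_const
      have hq := qf_pos hs h0
      have hc : ContinuousAt (fun ε => hz s k k ε z) 0 := by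
        unfold hz
        have a1 : qf s z + 0 ≠ 0 := by simpa using hq.ne'
        have a2 : Real.sqrt (qf s z + 0) ≠ 0 := by simpa using (Real.sqrt_pos.2 hq).ne'
        fun_prop (disch := assumption)
      exact hc.tendsto.comp ht)
  refine ge_of_tendsto' hlim fun n => ?_
  refine Jeps hd s hs k hΛ hsΛ (by positivity) ?_
  have : 1 / ((n:ℝ) + 1) ≤ 1 := by
    rw [div_le_one (by positivity)]; linarith [Nat.cast_nonneg (α := ℝ) n]
  linarith

lemma Joff {d : ℕ} (s : Fin d → ℝ) {i j : Fin d} (hij : i ≠ j) :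
    ∫ z, hz s i j 0 z * Real.exp (-1 * nsq z) = 0 := by
  let σ : Fin d → ℝ := fun k => if k = i then -1 else 1
  have hσ : ∀ k, σ k ^ 2 = 1 := fun k => by simp only [σ]; split_ifs <;> norm_num
  have mp : MeasurePreserving (fun (z : Fin d → ℝ) k => σ k * z k) volume volume := by
    apply volume_preserving_pi (f := fun k (x : ℝ) => σ k * x)
    intro k
    simp only [σ]
    split_ifs
    · simpa using Measure.measurePreserving_neg (volume : Measure ℝ)
    · simpa [id_def] using! MeasurePreserving.id (volume : Measure ℝ)
  have hinv : Function.Involutive (fun (z : Fin d → ℝ) k => σ k * z k) := by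
    intro z
    ext k
    have := hσ k
    show σ k * (σ k * z k) = z k
    rw [← mul_assoc, ← sq, this, one_mul]
  have hm : Measurable (fun (z : Fin d → ℝ) k => σ k * z k) := mp.measurable
  let E : (Fin d → ℝ) ≃ᵐ (Fin d → ℝ) := ⟨hinv.toPerm, hm, hm⟩
  have h := MeasurePreserving.integral_comp' (f := E) mp
    (fun z => hz s i j 0 z * Real.exp (-1 * nsq z))
  have h2 : ∀ z, hz s i j 0 (E z) * Real.exp (-1 * nsq (E z)) =
      -(hz s i j 0 z * Real.exp (-1 * nsq z)) := by
    intro z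
    have hE : E z = fun k => σ k * z k := rfl
    have hn : nsq (E z) = nsq z := by simp [hE, nsq, mul_pow, hσ]
    have hq : qf s (E z) = qf s z := by simp [hE, qf, mul_pow, hσ]
    rw [hz, hz, hn, hq, hE]
    simp only [hij, if_false, σ, if_true, hij.symm]
    ring
  simp_rw [h2, integral_neg] at h
  linarith

lemma core {d : ℕ} (hd : 2 ≤ d) (s : Fin d → ℝ) (hs : ∀ k, 0 < s k) {Λ : ℝ}
    (hΛ : 0 < Λ) (hsΛ : ∀ k, s k ^ 2 ≤ Λ) (u : Fin d → ℝ) :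
    (1 / 2) * Real.sqrt (Real.pi / 3) ^ d / Real.sqrt Λ * nsq u
      ≤ ∫ z, (∑ i, ∑ j, u i * u j * hz s i j 0 z) * Real.exp (-1 * nsq z) := by
  have hi : ∀ i j, Integrable (fun z => u i * u j * hz s i j 0 z * Real.exp (-1 * nsq z)) := by
    intro i j
    simpa only [mul_assoc] using
      ((integrable_hz1 hd s hs i j (le_refl 0)).const_mul (u j)).const_mul (u i)
  simp_rw [Finset.sum_mul]
  rw [integral_finsetSum _ (fun i _ => integrable_finsetSum _ fun j _ => hi i j), nsq,
    Finset.mul_sum]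
  apply Finset.sum_le_sum
  intro i _
  rw [integral_finsetSum _ fun j _ => hi i j, Finset.sum_eq_single i]
  · simp_rw [mul_assoc]
    rw [integral_const_mul, integral_const_mul]
    have := Jdiag hd s hs i hΛ hsΛ
    nlinarith [mul_le_mul_of_nonneg_left this (sq_nonneg (u i))]
  · intro j _ hj
    simp_rw [mul_assoc]
    rw [integral_const_mul, integral_const_mul, Joff s hj.symm]
    simp
  · simp

lemma spectral_aux {d : ℕ} (S : Matrix (Fin d) (Fin d) ℝ) (hS : S.PosDef) :
    ∃ (U : Matrix (Fin d) (Fin d) ℝ) (s : Fin d → ℝ), Uᵀ * U = 1 ∧ U * Uᵀ = 1 ∧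
      S = (U * diagonal s) * (U * diagonal s)ᵀ ∧ (∀ k, 0 < s k) ∧
      ∀ k, s k ^ 2 ≤ ‖Matrix.toEuclideanCLM (𝕜 := ℝ) (n := Fin d) S‖ := by
  have hH := hS.1
  let U : Matrix (Fin d) (Fin d) ℝ := hH.eigenvectorUnitary
  have hst : star U = Uᵀ := by rw [star_eq_conjTranspose, conjTranspose_eq_transpose_of_trivial]
  have hpos := hS.eigenvalues_pos
  refine ⟨U, fun k => Real.sqrt (hH.eigenvalues k), ?_, ?_, ?_,
    fun k => Real.sqrt_pos.2 (hpos k), ?_⟩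
  · rw [← hst]; exact Unitary.coe_star_mul_self hH.eigenvectorUnitary
  · rw [← hst]; exact Unitary.coe_mul_star_self hH.eigenvectorUnitary
  · have h := hH.spectral_theorem
    rw [Unitary.conjStarAlgAut_apply] at h
    conv_lhs => rw [h]
    rw [Matrix.transpose_mul, diagonal_transpose, ← Matrix.mul_assoc, Matrix.mul_assoc U _ (diagonal fun k => Real.sqrt (hH.eigenvalues k)),
      diagonal_mul_diagonal]
    have e : (fun i => Real.sqrt (hH.eigenvalues i) * Real.sqrt (hH.eigenvalues i)) =
        (RCLike.ofReal ∘ hH.eigenvalues : Fin d → ℝ) := by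
      ext i
      rw [Real.mul_self_sqrt (hpos i).le]; rfl
    rw [e]
    show U * _ * star U = _
    rw [hst]
  · intro k
    rw [Real.sq_sqrt (hpos k).le]
    have h1 := hH.mulVec_eigenvectorBasis k
    have h2 := (Matrix.toEuclideanCLM (𝕜 := ℝ) (n := Fin d) S).le_opNorm (hH.eigenvectorBasis k)
    have h3 : Matrix.toEuclideanCLM (𝕜 := ℝ) (n := Fin d) S (hH.eigenvectorBasis k) =
        hH.eigenvalues k • hH.eigenvectorBasis k := by
      ext i
      rw [Matrix.ofLp_toEuclideanCLM, h1]
      rfl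
    rw [h3, norm_smul, (hH.eigenvectorBasis).norm_eq_one, Real.norm_of_nonneg (hpos k).le] at h2
    simpa using h2

lemma change_var {d : ℕ} (L : Matrix (Fin d) (Fin d) ℝ) (hL : L.det ≠ 0) (a : Fin d → ℝ)
    (F : (Fin d → ℝ) → ℝ) :
    ∫ x, F x = ∫ z, F (a + L *ᵥ z) * |L.det| := by
  have hinj : Function.Injective (fun z : Fin d → ℝ => a + L *ᵥ z) := by
    intro x y h
    exact Matrix.mulVec_injective_of_isUnit ((Matrix.isUnit_iff_isUnit_det L).2 hL.isUnit)
      (add_left_cancel h)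
  have hsurj : Function.Surjective (fun z : Fin d → ℝ => a + L *ᵥ z) := by
    intro y
    refine ⟨L⁻¹ *ᵥ (y - a), ?_⟩
    simp [Matrix.mulVec_mulVec, Matrix.mul_nonsing_inv L hL.isUnit]
  have h := integral_image_eq_integral_abs_det_fderiv_smul (volume : Measure (Fin d → ℝ))
    (s := Set.univ) (f := fun z : Fin d → ℝ => a + L *ᵥ z)
    (f' := fun _ => LinearMap.toContinuousLinearMap (Matrix.toLin' L)) MeasurableSet.univ
    (fun x _ => by
      have := (LinearMap.toContinuousLinearMap (Matrix.toLin' L)).hasFDerivAt (x := x)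
      exact (this.const_add a).hasFDerivWithinAt)
    hinj.injOn F
  rw [Set.image_univ, hsurj.range_eq, setIntegral_univ, setIntegral_univ] at h
  rw [h]
  congr 1
  ext z
  rw [ContinuousLinearMap.det, LinearMap.coe_toContinuousLinearMap, LinearMap.det_toLin',
    smul_eq_mul, mul_comm]

lemma nsq_dot {d : ℕ} (z : Fin d → ℝ) : nsq z = z ⬝ᵥ z := by
  simp [nsq, dotProduct, sq]

lemma const_aux (d : ℕ) :
    (6 : ℝ) ^ (-(d : ℝ) / 2) = (2 * Real.pi) ^ (-(d : ℝ) / 2) * Real.sqrt (Real.pi / 3) ^ d := by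
  have hp := Real.pi_pos
  have h1 : Real.sqrt (Real.pi / 3) ^ d = (Real.pi / 3) ^ ((d:ℝ) / 2) := by
    rw [Real.sqrt_eq_rpow, ← Real.rpow_natCast, ← Real.rpow_mul (by positivity)]
    congr 1; ring
  have h2 : Real.pi / 3 = 2 * Real.pi / 6 := by ring
  rw [h1, h2, Real.div_rpow (by positivity) (by norm_num), neg_div, Real.rpow_neg (by norm_num),
    Real.rpow_neg (by positivity)]
  have : (0:ℝ) < (2 * Real.pi) ^ ((d:ℝ) / 2) := by positivity
  field_simp

lemma quad_nonneg {d : ℕ} (s u z : Fin d → ℝ) : 0 ≤ ∑ i, ∑ j, u i * u j * hz s i j 0 z := by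
  have e : ∑ i, ∑ j, u i * u j * hz s i j 0 z =
      (nsq u - (∑ i, u i * (s i * z i)) ^ 2 / qf s z) / Real.sqrt (qf s z) := by
    have e1 : ∀ i j, u i * u j * hz s i j 0 z =
        ((if i = j then u i * u j else 0) -
          (u i * (s i * z i)) * (u j * (s j * z j)) / qf s z) / Real.sqrt (qf s z) := by
      intro i j
      unfold hz
      rw [add_zero]
      split_ifs <;> ring
    simp_rw [e1, ← Finset.sum_div, Finset.sum_sub_distrib, ← Finset.sum_div]
    rw [sq (∑ i, _), Finset.sum_mul_sum]
    simp [nsq, sq]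
  rw [e]
  apply div_nonneg _ (Real.sqrt_nonneg _)
  rw [sub_nonneg]
  apply div_le_of_le_mul₀ (qf_nonneg s z) (nsq_nonneg u)
  have := Finset.sum_mul_sq_le_sq_mul_sq Finset.univ u (fun i => s i * z i)
  simpa [nsq, qf, mul_pow] using this

lemma nsq_sub_le {d : ℕ} (z n : Fin d → ℝ) : nsq (z - n) ≤ 2 * nsq z + 2 * nsq n := by
  simp only [nsq, Finset.mul_sum, ← Finset.sum_add_distrib]
  apply Finset.sum_le_sum
  intro i _
  simp only [Pi.sub_apply]
  nlinarith [sq_nonneg (z i + n i)]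

lemma nsq_sub_ge {d : ℕ} (z n : Fin d → ℝ) : nsq z ≤ 2 * nsq (z - n) + 2 * nsq n := by
  simp only [nsq, Finset.mul_sum, ← Finset.sum_add_distrib]
  apply Finset.sum_le_sum
  intro i _
  simp only [Pi.sub_apply]
  nlinarith [sq_nonneg (z i - 2 * n i)]

noncomputable def ww {d : ℕ} (n z : Fin d → ℝ) : ℝ :=
  (2 * Real.pi) ^ (-(d : ℝ) / 2) * Real.exp (-(1 / 2) * nsq (z - n))

lemma integrable_hzw {d : ℕ} (hd : 2 ≤ d) (s : Fin d → ℝ) (hs : ∀ k, 0 < s k) (n : Fin d → ℝ)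
    (i j : Fin d) : Integrable (fun z => hz s i j 0 z * ww n z) := by
  refine integrable_hz hd s hs i j (le_refl 0) (c := 1 / 4)
    (C := (2 * Real.pi) ^ (-(d : ℝ) / 2) * Real.exp (1 / 2 * nsq n)) (by norm_num) _ ?_ ?_
  · unfold ww
    have := (continuous_nsq (d := d)).measurable
    fun_prop
  · intro z
    unfold ww
    have hp := Real.pi_pos
    rw [abs_of_pos (by positivity), mul_assoc, ← Real.exp_add]
    gcongr
    linarith [nsq_sub_ge z n]

lemma K_psd {d : ℕ} (hd : 2 ≤ d) (s : Fin d → ℝ) (hs : ∀ k, 0 < s k) {Λ : ℝ}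
    (hΛ : 0 < Λ) (hsΛ : ∀ k, s k ^ 2 ≤ Λ) (n : Fin d → ℝ) :
    Matrix.PosSemidef ((Matrix.of fun i j => ∫ z, hz s i j 0 z * ww n z) -
      ((1 / 2) * (6 : ℝ) ^ (-(d : ℝ) / 2) * Real.exp (-nsq n) * Λ ^ (-(1:ℝ) / 2)) •
        (1 : Matrix (Fin d) (Fin d) ℝ)) := by
  refine .of_dotProduct_mulVec_nonneg ?_ fun u => ?_
  · ext i j
    have : ∀ z, hz s j i 0 z = hz s i j 0 z := by
      intro z
      simp only [hz, eq_comm (a := j), mul_comm (s j * z j)]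
    simp [this, Matrix.one_apply, eq_comm (a := j)]
  · have hp := Real.pi_pos
    have hi : ∀ i j, Integrable (fun z => u i * u j * hz s i j 0 z * ww n z) := by
      intro i j
      simpa only [mul_assoc] using
        ((integrable_hzw hd s hs n i j).const_mul (u j)).const_mul (u i)
    have hi1 : ∀ i j, Integrable (fun z => u i * u j * hz s i j 0 z * Real.exp (-1 * nsq z)) := by
      intro i j
      simpa only [mul_assoc] using
        ((integrable_hz1 hd s hs i j (le_refl 0)).const_mul (u j)).const_mul (u i)
    have e1 : u ⬝ᵥ (Matrix.of fun i j => ∫ z, hz s i j 0 z * ww n z) *ᵥ u =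
        ∫ z, (∑ i, ∑ j, u i * u j * hz s i j 0 z) * ww n z := by
      simp_rw [Finset.sum_mul]
      rw [integral_finsetSum _ (fun i _ => integrable_finsetSum _ fun j _ => hi i j)]
      simp only [dotProduct, mulVec, Finset.mul_sum, Matrix.of_apply]
      refine Finset.sum_congr rfl fun i _ => ?_
      rw [integral_finsetSum _ fun j _ => hi i j]
      refine Finset.sum_congr rfl fun j _ => ?_
      simp_rw [mul_assoc]
      rw [integral_const_mul, integral_const_mul]
      ring
    have hlow : ∫ z, ((2 * Real.pi) ^ (-(d : ℝ) / 2) * Real.exp (-nsq n)) *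
          ((∑ i, ∑ j, u i * u j * hz s i j 0 z) * Real.exp (-1 * nsq z)) ≤
        ∫ z, (∑ i, ∑ j, u i * u j * hz s i j 0 z) * ww n z := by
      refine integral_mono ?_ ?_ fun z => ?_
      · simp_rw [Finset.sum_mul]
        exact (integrable_finsetSum _ fun i _ => integrable_finsetSum _ fun j _ => hi1 i j).const_mul _
      · simp_rw [Finset.sum_mul]
        exact (integrable_finsetSum _ fun i _ => integrable_finsetSum _ fun j _ => hi i j)
      · have hw : (2 * Real.pi) ^ (-(d : ℝ) / 2) * Real.exp (-nsq n) * Real.exp (-1 * nsq z)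
            ≤ ww n z := by
          unfold ww
          rw [mul_assoc, ← Real.exp_add]
          gcongr
          linarith [nsq_sub_le z n]
        have := mul_le_mul_of_nonneg_left hw (quad_nonneg s u z)
        show _ * (_ * _) ≤ _
        linarith
    rw [integral_const_mul] at hlow
    have hc := core hd s hs hΛ hsΛ u
    have hc2 := mul_le_mul_of_nonneg_left hc
      (show 0 ≤ (2 * Real.pi) ^ (-(d : ℝ) / 2) * Real.exp (-nsq n) by positivity)
    have e2 : Λ ^ (-(1:ℝ) / 2) = 1 / Real.sqrt Λ := by
      rw [neg_div, Real.rpow_neg hΛ.le, Real.sqrt_eq_rpow, one_div, one_div]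
    rw [star_trivial, Matrix.sub_mulVec, dotProduct_sub, e1, Matrix.smul_mulVec, one_mulVec,
      dotProduct_smul, smul_eq_mul, ← nsq_dot, const_aux, e2, sub_nonneg]
    refine le_trans (le_of_eq ?_) (hc2.trans hlow)
    ring

/-- For `d ≥ 2` and `X ~ N(μ, Σ)` with `Σ` positive definite, the expected Hessian of
`x ↦ ‖x − x⋆‖₂` at `X`, namely `E[(I − (X−x⋆)(X−x⋆)ᵀ/‖X−x⋆‖²)/‖X−x⋆‖]`, dominates
`(1/2)·6^{−d/2}·exp(−(μ−x⋆)ᵀΣ⁻¹(μ−x⋆))·‖Σ‖^{−1/2}·I` in the Loewner order, where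
`‖Σ‖` is the operator norm of `Σ`. -/
theorem stmt_7 (d : ℕ) (hd : 2 ≤ d) (μ xs : Fin d → ℝ)
    (S : Matrix (Fin d) (Fin d) ℝ) (hS : S.PosDef) :
    Matrix.PosSemidef
      ((Matrix.of fun i j =>
          ∫ x : Fin d → ℝ,
            (((if i = j then (1 : ℝ) else 0) -
                (x - xs) i * (x - xs) j / (∑ k, ((x - xs) k) ^ 2)) /
              Real.sqrt (∑ k, ((x - xs) k) ^ 2)) * gaussPdf d μ S x) -
        ((1 / 2) * (6 : ℝ) ^ (-(d : ℝ) / 2) *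
            Real.exp (-((μ - xs) ⬝ᵥ S⁻¹.mulVec (μ - xs))) *
            ‖Matrix.toEuclideanCLM (𝕜 := ℝ) (n := Fin d) S‖ ^ (-(1 : ℝ) / 2)) •
          (1 : Matrix (Fin d) (Fin d) ℝ)) := by
  obtain ⟨U, s, hU1, hU2, hSL, hs, hsΛ⟩ := spectral_aux S hS
  set L := U * diagonal s with hLdef
  set Λ := ‖Matrix.toEuclideanCLM (𝕜 := ℝ) (n := Fin d) S‖ with hΛdef
  have hΛ : 0 < Λ := lt_of_lt_of_le (pow_pos (hs ⟨0, by omega⟩) 2) (hsΛ _)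
  have hdetS : S.det = L.det ^ 2 := by rw [hSL, det_mul, det_transpose, sq]
  have hdet : L.det ≠ 0 := by
    intro h
    have := hS.det_pos
    rw [hdetS, h] at this
    simp at this
  have hLu : IsUnit L.det := hdet.isUnit
  have hLtu : IsUnit Lᵀ.det := by rwa [det_transpose]
  set n := L⁻¹ *ᵥ (μ - xs) with hn
  have hLn : L *ᵥ n = μ - xs := by
    rw [hn, mulVec_mulVec, mul_nonsing_inv L hLu, one_mulVec]
  have hquad : ∀ z, (L *ᵥ z) ⬝ᵥ S⁻¹ *ᵥ (L *ᵥ z) = nsq z := by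
    intro z
    rw [nsq_dot, hSL, Matrix.mul_inv_rev, mulVec_mulVec, Matrix.mul_assoc, nonsing_inv_mul L hLu,
      Matrix.mul_one, dotProduct_mulVec, vecMul_mulVec, Matrix.mul_nonsing_inv Lᵀ hLtu,
      vecMul_one]
  have hLz : ∀ z i, (L *ᵥ z) i = ∑ a, U i a * (s a * z a) := by
    intro z i
    simp only [hLdef, mulVec, dotProduct, mul_diagonal, mul_assoc]
  have hnsqL : ∀ z, ∑ k, ((L *ᵥ z) k) ^ 2 = qf s z := by
    intro z
    have h1 : ∑ k, ((L *ᵥ z) k) ^ 2 = (L *ᵥ z) ⬝ᵥ (L *ᵥ z) := nsq_dot _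
    have h2 : L *ᵥ z = U *ᵥ (fun a => s a * z a) := by
      ext i; rw [hLz]; rfl
    rw [h1, h2, dotProduct_mulVec, vecMul_mulVec, hU1, vecMul_one]
    simp only [dotProduct, qf]
    refine Finset.sum_congr rfl fun k _ => ?_
    ring
  have hdensity : ∀ z, gaussPdf d μ S (xs + L *ᵥ z) * |L.det| = ww n z := by
    intro z
    have h1 : xs + L *ᵥ z - μ = L *ᵥ (z - n) := by
      rw [mulVec_sub, hLn]; abel
    have h2 : Real.sqrt S.det⁻¹ * |L.det| = 1 := by
      rw [hdetS, Real.sqrt_inv, Real.sqrt_sq_eq_abs, inv_mul_cancel₀ (abs_ne_zero.2 hdet)]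
    unfold gaussPdf ww
    rw [h1, hquad]
    linear_combination ((2 * Real.pi) ^ (-(d : ℝ) / 2) * Real.exp (-(1 / 2) * nsq (z - n))) * h2
  have hK := K_psd hd s hs hΛ hsΛ n
  have hmain := hK.mul_mul_conjTranspose_same U
  rw [conjTranspose_eq_transpose_of_trivial, Matrix.mul_sub, Matrix.sub_mul, Matrix.mul_smul,
    Matrix.smul_mul, Matrix.mul_one, hU2] at hmain
  have hqn : (μ - xs) ⬝ᵥ S⁻¹ *ᵥ (μ - xs) = nsq n := by rw [← hLn, hquad]
  rw [hqn]
  convert hmain using 2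
  ext i j
  rw [Matrix.of_apply, change_var L hdet xs]
  have hint : ∀ z, (((if i = j then (1 : ℝ) else 0) -
      (xs + L *ᵥ z - xs) i * (xs + L *ᵥ z - xs) j / (∑ k, ((xs + L *ᵥ z - xs) k) ^ 2)) /
      Real.sqrt (∑ k, ((xs + L *ᵥ z - xs) k) ^ 2)) * gaussPdf d μ S (xs + L *ᵥ z) * |L.det| =
      ∑ b, ∑ a, U i a * U j b * (hz s a b 0 z * ww n z) := by
    intro z
    rw [mul_assoc, hdensity, add_sub_cancel_left, hnsqL]
    have hδ : (if i = j then (1 : ℝ) else 0) = ∑ b, ∑ a, U i a * U j b * (if a = b then 1 else 0) := by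
      have := congrFun (congrFun hU2 i) j
      rw [Matrix.one_apply, Matrix.mul_apply] at this
      rw [← this]
      simp
    have hLL : (L *ᵥ z) i * (L *ᵥ z) j =
        ∑ b, ∑ a, U i a * U j b * (s a * z a * (s b * z b)) := by
      rw [hLz, hLz, Finset.sum_mul_sum, Finset.sum_comm]
      refine Finset.sum_congr rfl fun b _ => Finset.sum_congr rfl fun a _ => ?_
      ring
    rw [hδ, hLL, Finset.sum_div, ← Finset.sum_sub_distrib, Finset.sum_div, Finset.sum_mul]
    refine Finset.sum_congr rfl fun b _ => ?_
    rw [Finset.sum_div, ← Finset.sum_sub_distrib, Finset.sum_div, Finset.sum_mul]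
    refine Finset.sum_congr rfl fun a _ => ?_
    unfold hz
    rw [add_zero]
    ring
  simp_rw [hint]
  have hI : ∀ a b, Integrable (fun z => U i a * U j b * (hz s a b 0 z * ww n z)) :=
    fun a b => (integrable_hzw hd s hs n a b).const_mul _
  rw [integral_finsetSum _ fun b _ => integrable_finsetSum _ fun a _ => hI a b, Matrix.mul_apply]
  refine Finset.sum_congr rfl fun b _ => ?_
  rw [integral_finsetSum _ fun a _ => hI a b, Matrix.mul_apply, Finset.sum_mul]
  refine Finset.sum_congr rfl fun a _ => ?_
  rw [integral_const_mul, Matrix.of_apply, Matrix.transpose_apply]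
  ring
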